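/- Let A be a finite ring and let M, N be finite A-modules. Then |Hom_A(M,N)| · Σ_{[L]} P^L_{M,N} / a_L = |Ext¹_A(M,N)|, where the sum ranges over isomorphism classes of finite A-modules and has only finitely many nonzero terms; in particular Ext¹_A(M,N) is a finite group. -/

import Mathlib

open CategoryTheory

universe w

/-- A bundled finite left module over the ring `A`. -/
structure FinMod (A : Type) [Ring A] : Type 1 where
  /-- the underlying type -/
  carrier : Type
  [addCommGroup : AddCommGroup carrier]
  [module : Module A carrier]
  [finite : Finite carrier]

attribute [instance] FinMod.addCommGroup FinMod.module FinMod.finite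

/-- `autCard A M` is `a_M`, the number of `A`-module automorphisms of `M`. -/
noncomputable def autCard (A : Type) [Ring A] (M : Type) [AddCommGroup M] [Module A M] : ℕ :=
  Nat.card (M ≃ₗ[A] M)

/-- `hallP A M N R` is `P^R_{M,N}`, the number of short exact sequences `0 → N → R → M → 0`. -/
noncomputable def hallP (A : Type) [Ring A] (M N R : Type)
    [AddCommGroup M] [Module A M] [AddCommGroup N] [Module A N]
    [AddCommGroup R] [Module A R] : ℕ :=
  Nat.card {ab : (N →ₗ[A] R) × (R →ₗ[A] M) //
    Function.Injective ab.1 ∧ Function.Surjective ab.2 ∧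
      LinearMap.range ab.1 = LinearMap.ker ab.2}

/-- In an exact sequence `X → Y → E → 0` of additive groups, the cardinalities satisfy
`|E| * |X| = |ker (X → Y)| * |Y|`. -/
lemma AddMonoidHom.card_mul_card_of_exact {X Y E : Type*} [AddCommGroup X] [AddCommGroup Y]
    [AddCommGroup E] (r : X →+ Y) (d : Y →+ E) (h : Function.Exact r d)
    (hd : Function.Surjective d) :
    Nat.card E * Nat.card X = Nat.card r.ker * Nat.card Y := by
  have hE : Nat.card d.range = Nat.card E := by
    rw [AddMonoidHom.range_eq_top.2 hd]
    exact Nat.card_congr AddSubgroup.topEquiv.toEquiv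
  have hker : d.ker = r.range := by
    ext y
    exact h y
  have hX := AddSubgroup.card_mul_index r.ker
  have hY := AddSubgroup.card_mul_index d.ker
  rw [AddSubgroup.index_ker] at hX hY
  rw [hE, hker] at hY
  rw [← hX, ← hY]
  ring

section

variable {A M N P L X : Type*} [Ring A] [AddCommGroup M] [Module A M] [AddCommGroup N]
  [Module A N] [AddCommGroup P] [Module A P] [AddCommGroup L] [Module A L] [AddCommGroup X]
  [Module A X]

lemma LinearMap.finite_of_finite [Finite M] [Finite N] : Finite (M →ₗ[A] N) :=
  DFunLike.finite _

/-- A map killed by the surjection of a short exact sequence factors through the injection. -/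
lemma LinearMap.exists_comp_eq_of_range_eq_ker {a : N →ₗ[A] L} {b : L →ₗ[A] M}
    (ha : Function.Injective a) (hab : LinearMap.range a = LinearMap.ker b) (h : X →ₗ[A] L)
    (hh : b ∘ₗ h = 0) : ∃ g : X →ₗ[A] N, a ∘ₗ g = h := by
  have hmem (x : X) : h x ∈ LinearMap.range a := by
    rw [hab]
    exact LinearMap.congr_fun hh x
  refine ⟨(LinearEquiv.ofInjective a ha).symm ∘ₗ h.codRestrict _ hmem, ?_⟩
  ext x
  have := LinearEquiv.apply_symm_apply (LinearEquiv.ofInjective a ha) (h.codRestrict _ hmem x)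
  exact congrArg Subtype.val this

/-- Maps out of the quotient of `π` are the maps out of its source that vanish on `ker π`. -/
lemma LinearMap.card_ker_restrict (π : P →ₗ[A] M) (hπ : Function.Surjective π)
    (r : (P →ₗ[A] N) →+ (LinearMap.ker π →ₗ[A] N))
    (hr : ∀ g, r g = g ∘ₗ (LinearMap.ker π).subtype) :
    Nat.card r.ker = Nat.card (M →ₗ[A] N) := by
  symm
  refine Nat.card_congr (Equiv.ofBijective
    (fun f : M →ₗ[A] N ↦ (⟨f ∘ₗ π, ?_⟩ : r.ker)) ⟨fun f g h ↦ ?_, fun g ↦ ?_⟩)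
  · rw [AddMonoidHom.mem_ker, hr]
    ext x
    simp
  · exact (LinearMap.cancel_right hπ).1 (congrArg Subtype.val h)
  · have hg : LinearMap.ker π ≤ LinearMap.ker g.1 := fun x hx ↦ by
      have := g.2
      rw [AddMonoidHom.mem_ker, hr] at this
      exact LinearMap.congr_fun this ⟨x, hx⟩
    refine ⟨(LinearMap.ker π).liftQ g.1 hg ∘ₗ (π.quotKerEquivOfSurjective hπ).symm, ?_⟩
    ext x
    have : (π.quotKerEquivOfSurjective hπ).symm (π x) = (LinearMap.ker π).mkQ x := by
      rw [LinearEquiv.symm_apply_eq]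
      simp
    simp [this]

/-- The pairs of maps that form a short exact sequence `0 → N → L → M → 0`. -/
abbrev ShortExactPair (A M N L : Type*) [Ring A] [AddCommGroup M] [Module A M] [AddCommGroup N]
    [Module A N] [AddCommGroup L] [Module A L] :=
  {ab : (N →ₗ[A] L) × (L →ₗ[A] M) //
    Function.Injective ab.1 ∧ Function.Surjective ab.2 ∧
      LinearMap.range ab.1 = LinearMap.ker ab.2}

/-- Lifts of a map from a projective module through the surjection of a short exact sequence
form a torsor under the maps to the submodule. -/
lemma ShortExactPair.card_lifts [Module.Projective A P] (π : P →ₗ[A] M)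
    (s : ShortExactPair A M N L) :
    Nat.card {φ : P →ₗ[A] L // s.1.2 ∘ₗ φ = π} = Nat.card (P →ₗ[A] N) := by
  obtain ⟨⟨a, b⟩, ha, hb, hab⟩ := s
  dsimp only at ha hb hab ⊢
  obtain ⟨φ₀, h₀⟩ := Module.projective_lifting_property b π hb
  have hba : b ∘ₗ a = 0 := LinearMap.range_le_ker_iff.1 hab.le
  symm
  refine Nat.card_congr (Equiv.ofBijective
    (fun g : P →ₗ[A] N ↦ (⟨φ₀ + a ∘ₗ g, ?_⟩ : {φ : P →ₗ[A] L // b ∘ₗ φ = π}))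
    ⟨fun f g h ↦ ?_, fun φ ↦ ?_⟩)
  · rw [LinearMap.comp_add, ← LinearMap.comp_assoc, hba, h₀, LinearMap.zero_comp, add_zero]
  · exact (LinearMap.cancel_left ha).1 (add_left_cancel (congrArg Subtype.val h))
  · obtain ⟨g, hg⟩ := LinearMap.exists_comp_eq_of_range_eq_ker ha hab (φ.1 - φ₀)
      (by rw [LinearMap.comp_sub, φ.2, h₀, sub_self])
    exact ⟨g, Subtype.ext (by simp [hg])⟩

variable (N) in
/-- The pushout of `N ← ker π → P` along `f : ker π → N` and the inclusion. -/
abbrev KerPushout (π : P →ₗ[A] M) (f : LinearMap.ker π →ₗ[A] N) :=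
  (N × P) ⧸ LinearMap.range (f.prod (-(LinearMap.ker π).subtype))

namespace KerPushout

variable (π : P →ₗ[A] M) (f : LinearMap.ker π →ₗ[A] N)

/-- The projection of the pushout to `M`. -/
def proj : KerPushout N π f →ₗ[A] M :=
  Submodule.liftQ _ (LinearMap.coprod 0 π) (by rintro _ ⟨k, rfl⟩; simp)

@[simp]
lemma proj_mk (n : N) (p : P) : proj π f (Submodule.Quotient.mk (n, p)) = π p := by
  simp [proj]

lemma proj_surjective (hπ : Function.Surjective π) : Function.Surjective (proj π f) := fun m ↦ by
  obtain ⟨p, rfl⟩ := hπ m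
  exact ⟨_, proj_mk π f 0 p⟩

instance [Finite N] [Finite P] : Finite (KerPushout N π f) :=
  .of_surjective _ (Submodule.mkQ_surjective _)

lemma mk_eq_mk_iff (n n' : N) (p p' : P) :
    (Submodule.Quotient.mk (n, p) : KerPushout N π f) = Submodule.Quotient.mk (n', p') ↔
      ∃ k : LinearMap.ker π, f k = n - n' ∧ (k : P) = p' - p := by
  rw [Submodule.Quotient.eq]
  simp [LinearMap.mem_range, neg_eq_iff_eq_neg]

/-- The coprojection from `N`. -/
def inl : N →ₗ[A] KerPushout N π f := Submodule.mkQ _ ∘ₗ LinearMap.inl A N P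

/-- The coprojection from `P`. -/
def inr : P →ₗ[A] KerPushout N π f := Submodule.mkQ _ ∘ₗ LinearMap.inr A N P

lemma inl_apply (n : N) : inl π f n = Submodule.Quotient.mk (n, 0) := rfl

lemma inr_apply (p : P) : inr π f p = Submodule.Quotient.mk (0, p) := rfl

lemma inl_injective : Function.Injective (inl π f) := fun n n' h ↦ by
  rw [inl_apply, inl_apply, mk_eq_mk_iff] at h
  obtain ⟨k, hk, hk'⟩ := h
  rw [sub_zero, ZeroMemClass.coe_eq_zero] at hk'
  rw [hk', map_zero] at hk
  exact sub_eq_zero.1 hk.symm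

lemma range_inl : LinearMap.range (inl π f) = LinearMap.ker (proj π f) := by
  ext x
  obtain ⟨⟨n, p⟩, rfl⟩ := Submodule.Quotient.mk_surjective _ x
  rw [LinearMap.mem_ker, proj_mk, LinearMap.mem_range]
  simp only [inl_apply, mk_eq_mk_iff]
  constructor
  · rintro ⟨n', k, -, hk⟩
    rw [← sub_zero p, ← hk]
    exact k.2
  · intro hp
    exact ⟨n + f ⟨p, hp⟩, ⟨p, hp⟩, by simp, by simp⟩

lemma inr_comp_subtype : inr π f ∘ₗ (LinearMap.ker π).subtype = inl π f ∘ₗ f := by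
  ext k
  simp only [LinearMap.comp_apply, inl_apply, inr_apply, Submodule.subtype_apply, mk_eq_mk_iff]
  exact ⟨-k, by simp, by simp⟩

variable {π f} in
lemma hom_ext {g h : KerPushout N π f →ₗ[A] L} (h₁ : g ∘ₗ inl π f = h ∘ₗ inl π f)
    (h₂ : g ∘ₗ inr π f = h ∘ₗ inr π f) : g = h :=
  Submodule.linearMap_qext _ (LinearMap.prod_ext h₁ h₂)

/-- An extension `0 → N → L → M → 0` with a lift of `π` inducing `f` identifies `L` with the
pushout along `f`. -/
lemma exists_equiv {a : N →ₗ[A] L} {b : L →ₗ[A] M} {φ : P →ₗ[A] L}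
    (hπ : Function.Surjective π) (ha : Function.Injective a)
    (hab : LinearMap.range a = LinearMap.ker b) (hφ : b ∘ₗ φ = π)
    (hf : φ ∘ₗ (LinearMap.ker π).subtype = a ∘ₗ f) :
    ∃ e : KerPushout N π f ≃ₗ[A] L,
      e.toLinearMap ∘ₗ inl π f = a ∧ e.toLinearMap ∘ₗ inr π f = φ ∧
        proj π f ∘ₗ e.symm.toLinearMap = b := by
  have hf' (k : LinearMap.ker π) : φ k = a (f k) := LinearMap.congr_fun hf k
  have hφ' (p : P) : b (φ p) = π p := LinearMap.congr_fun hφ p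
  have hba (n : N) : b (a n) = 0 := LinearMap.congr_fun (LinearMap.range_le_ker_iff.1 hab.le) n
  let c : KerPushout N π f →ₗ[A] L :=
    Submodule.liftQ _ (a.coprod φ) (by rintro _ ⟨k, rfl⟩; simp [hf'])
  have hc (n : N) (p : P) : c (Submodule.Quotient.mk (n, p)) = a n + φ p := by simp [c]
  have hbc : b ∘ₗ c = proj π f := by
    apply hom_ext <;> ext x <;> simp [inl_apply, inr_apply, hc, hba, hφ']
  have hinj : Function.Injective c := by
    rw [injective_iff_map_eq_zero]
    intro x hx
    have hx' : x ∈ LinearMap.ker (proj π f) := by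
      rw [← hbc, LinearMap.mem_ker, LinearMap.comp_apply, hx, map_zero]
    rw [← range_inl] at hx'
    obtain ⟨n, rfl⟩ := hx'
    rw [inl_apply, hc, map_zero, add_zero] at hx
    rw [(injective_iff_map_eq_zero a).1 ha n hx, map_zero]
  have hsurj : Function.Surjective c := fun l ↦ by
    obtain ⟨p, hp⟩ := hπ (b l)
    have : l - φ p ∈ LinearMap.range a := by
      rw [hab, LinearMap.mem_ker, map_sub, hφ', hp, sub_self]
    obtain ⟨n, hn⟩ := this
    exact ⟨Submodule.Quotient.mk (n, p), by rw [hc, hn, sub_add_cancel]⟩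
  let e := LinearEquiv.ofBijective c ⟨hinj, hsurj⟩
  refine ⟨e, ?_, ?_, ?_⟩
  · ext n
    exact (hc n 0).trans (by simp)
  · ext p
    exact (hc 0 p).trans (by simp)
  · rw [← hbc]
    ext l
    exact congrArg b (e.apply_symm_apply l)

end KerPushout

/-- Short exact sequences `0 → N → L → M → 0` together with a lift `P → L` of `π : P → M`. -/
abbrev ShortExactPair.WithLift (N L : Type*) [AddCommGroup N] [Module A N] [AddCommGroup L]
    [Module A L] (π : P →ₗ[A] M) :=
  (s : ShortExactPair A M N L) × {φ : P →ₗ[A] L // s.1.2 ∘ₗ φ = π}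

/-- The extension and the lift given by an isomorphism from a pushout. -/
def ShortExactPair.withLiftOfEquiv {π : P →ₗ[A] M} (hπ : Function.Surjective π)
    {f : LinearMap.ker π →ₗ[A] N} (e : KerPushout N π f ≃ₗ[A] L) :
    ShortExactPair.WithLift N L π where
  fst := ⟨(e.toLinearMap ∘ₗ KerPushout.inl π f, KerPushout.proj π f ∘ₗ e.symm.toLinearMap),
    e.injective.comp (KerPushout.inl_injective π f),
    (KerPushout.proj_surjective π f hπ).comp e.symm.surjective, by
      dsimp only
      rw [LinearMap.range_comp, LinearMap.ker_comp, KerPushout.range_inl]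
      exact Submodule.map_equiv_eq_comap_symm e _⟩
  snd := ⟨e.toLinearMap ∘ₗ KerPushout.inr π f, by
    ext p
    simp [KerPushout.inr_apply]⟩

/-- Short exact sequences `0 → N → L → M → 0` with a lift `P → L` of `π : P → M` inducing `f` on
`ker π` are the same as isomorphisms from the pushout along `f` to `L`. -/
lemma ShortExactPair.card_withLift_inducing (π : P →ₗ[A] M) (hπ : Function.Surjective π)
    (f : LinearMap.ker π →ₗ[A] N) :
    Nat.card {t : ShortExactPair.WithLift N L π //
        t.2.1 ∘ₗ (LinearMap.ker π).subtype = t.1.1.1 ∘ₗ f} =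
      Nat.card (KerPushout N π f ≃ₗ[A] L) := by
  symm
  refine Nat.card_congr (Equiv.ofBijective
    (fun e ↦ ⟨ShortExactPair.withLiftOfEquiv hπ e, ?_⟩) ⟨fun e e' h ↦ ?_, ?_⟩)
  · change (e.toLinearMap ∘ₗ KerPushout.inr π f) ∘ₗ (LinearMap.ker π).subtype =
      (e.toLinearMap ∘ₗ KerPushout.inl π f) ∘ₗ f
    rw [LinearMap.comp_assoc, KerPushout.inr_comp_subtype, LinearMap.comp_assoc]
  · have h₁ : e.toLinearMap ∘ₗ KerPushout.inl π f = e'.toLinearMap ∘ₗ KerPushout.inl π f :=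
      congrArg (fun t ↦ t.1.1.1.1) h
    have h₂ : e.toLinearMap ∘ₗ KerPushout.inr π f = e'.toLinearMap ∘ₗ KerPushout.inr π f :=
      congrArg (fun t ↦ t.1.2.1) h
    exact LinearEquiv.toLinearMap_injective (KerPushout.hom_ext h₁ h₂)
  · rintro ⟨⟨⟨⟨a, b⟩, ha, hb, hab⟩, φ, hφ⟩, hf⟩
    obtain ⟨e, rfl, rfl, rfl⟩ := KerPushout.exists_equiv π f hπ ha hab hφ hf
    exact ⟨e, rfl⟩

/-- The number of short exact sequences `0 → N → L → M → 0`, in terms of pushouts along a surjection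
`π : P → M` from a projective module. -/
lemma ShortExactPair.card_mul_card_eq_sum [Module.Projective A P] [Finite M] [Finite N] [Finite P]
    [Finite L] (π : P →ₗ[A] M) (hπ : Function.Surjective π)
    [Fintype (LinearMap.ker π →ₗ[A] N)] :
    Nat.card (ShortExactPair A M N L) * Nat.card (P →ₗ[A] N) =
      ∑ f : LinearMap.ker π →ₗ[A] N, Nat.card (KerPushout N π f ≃ₗ[A] L) := by
  have := LinearMap.finite_of_finite (A := A) (M := N) (N := L)
  have := LinearMap.finite_of_finite (A := A) (M := L) (N := M)
  have := LinearMap.finite_of_finite (A := A) (M := P) (N := L)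
  have := Fintype.ofFinite (ShortExactPair A M N L)
  have hT : Nat.card (ShortExactPair.WithLift N L π) =
      Nat.card (ShortExactPair A M N L) * Nat.card (P →ₗ[A] N) := by
    rw [Nat.card_sigma]
    simp [ShortExactPair.card_lifts]
  have hex (t : ShortExactPair.WithLift N L π) :
      ∃ f : LinearMap.ker π →ₗ[A] N, t.1.1.1 ∘ₗ f = t.2.1 ∘ₗ (LinearMap.ker π).subtype := by
    refine LinearMap.exists_comp_eq_of_range_eq_ker t.1.2.1 t.1.2.2.2 _ ?_
    rw [← LinearMap.comp_assoc, t.2.2]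
    ext k
    simp
  choose F hF using hex
  rw [← hT, ← Nat.card_congr (Equiv.sigmaFiberEquiv F), Nat.card_sigma]
  refine Finset.sum_congr rfl fun f _ ↦ ?_
  rw [← ShortExactPair.card_withLift_inducing π hπ f]
  refine Nat.card_congr (Equiv.subtypeEquivRight fun t ↦ ?_)
  rw [← hF, LinearMap.cancel_left t.1.2.1]

end

/-- For a surjection `π : P → M` from a projective module, the group `Ext¹(M, N)` is the cokernel of
`Hom(P, N) → Hom(ker π, N)`. -/
lemma exists_restrict_exact_ext {A M N P : Type} [Ring A] [HasExt.{w} (ModuleCat A)]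
    [AddCommGroup M] [Module A M] [AddCommGroup N] [Module A N] [AddCommGroup P] [Module A P]
    [Module.Projective A P] (π : P →ₗ[A] M) (hπ : Function.Surjective π) :
    ∃ (r : (P →ₗ[A] N) →+ (LinearMap.ker π →ₗ[A] N))
      (d : (LinearMap.ker π →ₗ[A] N) →+ Abelian.Ext (ModuleCat.of A M) (ModuleCat.of A N) 1),
      (∀ g, r g = g ∘ₗ (LinearMap.ker π).subtype) ∧ Function.Exact r d ∧
        Function.Surjective d := by
  let S := ModuleCat.shortComplexOfCompEqZero (LinearMap.ker π).subtype π (by ext; simp)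
  have hS : S.ShortExact := ModuleCat.shortComplex_shortExact S
    (LinearMap.exact_subtype_ker_map π) (Submodule.injective_subtype _) hπ
  have : Projective S.X₂ := (IsProjective.iff_projective P).1 inferInstance
  let r : (P →ₗ[A] N) →+ (LinearMap.ker π →ₗ[A] N) :=
    { toFun g := g ∘ₗ (LinearMap.ker π).subtype
      map_zero' := LinearMap.zero_comp _
      map_add' _ _ := LinearMap.add_comp _ _ _ }
  let d : (LinearMap.ker π →ₗ[A] N) →+
      Abelian.Ext (ModuleCat.of A M) (ModuleCat.of A N) 1 :=
    { toFun g := hS.extClass.comp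
        (Abelian.Ext.mk₀ (ModuleCat.ofHom g : S.X₁ ⟶ ModuleCat.of A N)) (add_zero 1)
      map_zero' := by simp
      map_add' _ _ := by simp [Abelian.Ext.mk₀_add] }
  refine ⟨r, d, fun g ↦ rfl, fun g ↦ ⟨fun hg ↦ ?_, ?_⟩, fun x ↦ ?_⟩
  · obtain ⟨x, hx⟩ := Abelian.Ext.contravariant_sequence_exact₁ hS _ _ (add_zero 1) hg
    obtain ⟨y, rfl⟩ := (Abelian.Ext.mk₀_bijective _ _).2 x
    rw [Abelian.Ext.mk₀_comp_mk₀] at hx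
    have := (Abelian.Ext.mk₀_bijective _ _).1 hx
    exact ⟨y.hom, congrArg ModuleCat.Hom.hom this⟩
  · rintro ⟨y, rfl⟩
    change hS.extClass.comp (Abelian.Ext.mk₀ (S.f ≫ ModuleCat.ofHom y)) (add_zero 1) = 0
    rw [← Abelian.Ext.mk₀_comp_mk₀]
    exact hS.extClass_comp_assoc _
  · obtain ⟨x, rfl⟩ := Abelian.Ext.contravariant_sequence_exact₃ hS (ModuleCat.of A N) x
      (Abelian.Ext.eq_zero_of_projective _) (add_zero 1)
    obtain ⟨y, rfl⟩ := (Abelian.Ext.mk₀_bijective _ _).2 x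
    exact ⟨y.hom, rfl⟩

/-- For a finite ring `A` and finite `A`-modules `M, N`:
`|Hom_A(M,N)| · Σ_{[L]} P^L_{M,N}/a_L = |Ext¹_A(M,N)|`, the sum running over a complete
irredundant family of representatives of the isomorphism classes of finite `A`-modules;
the sum has finite support and `Ext¹_A(M,N)` is a finite group. -/
theorem hom_mul_sum_hallP_div_aut_eq_card_ext
    (A : Type) [Ring A] [Finite A] [HasExt.{w} (ModuleCat A)]
    (M N : Type)
    [AddCommGroup M] [Module A M] [Finite M]
    [AddCommGroup N] [Module A N] [Finite N]
    (ι : Type) (V : ι → FinMod A)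
    (hrep : ∀ W : FinMod A, ∃! i : ι, Nonempty (W.carrier ≃ₗ[A] (V i).carrier)) :
    Finite (Abelian.Ext (ModuleCat.of A M) (ModuleCat.of A N) 1) ∧
    (Function.support fun i : ι =>
      (hallP A M N (V i).carrier : ℚ) / (autCard A (V i).carrier : ℚ)).Finite ∧
    (Nat.card (M →ₗ[A] N) : ℚ) *
        (∑ᶠ i : ι, (hallP A M N (V i).carrier : ℚ) / (autCard A (V i).carrier : ℚ))
      = (Nat.card (Abelian.Ext (ModuleCat.of A M) (ModuleCat.of A N) 1) : ℚ) := by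
  classical
  have hP : Finite (M →₀ A) := .of_injective _ DFunLike.coe_injective
  let π : (M →₀ A) →ₗ[A] M := Finsupp.linearCombination A id
  have hπ : Function.Surjective π := Finsupp.linearCombination_id_surjective A M
  have := LinearMap.finite_of_finite (A := A) (M := LinearMap.ker π) (N := N)
  have := LinearMap.finite_of_finite (A := A) (M := M →₀ A) (N := N)
  have := Fintype.ofFinite (LinearMap.ker π →ₗ[A] N)
  obtain ⟨r, d, hr, hrd, hd⟩ := exists_restrict_exact_ext.{w} (N := N) π hπ
  have hcard := AddMonoidHom.card_mul_card_of_exact r d hrd hd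
  rw [LinearMap.card_ker_restrict π hπ r hr] at hcard
  choose c hc hc' using fun f : LinearMap.ker π →ₗ[A] N ↦ hrep ⟨KerPushout N π f⟩
  have hiso (f : LinearMap.ker π →ₗ[A] N) (i : ι) :
      (Nat.card (KerPushout N π f ≃ₗ[A] (V i).carrier) : ℚ) / autCard A (V i).carrier =
        if c f = i then 1 else 0 := by
    split_ifs with h
    · subst h
      obtain ⟨e⟩ := hc f
      have : Finite ((V (c f)).carrier ≃ₗ[A] (V (c f)).carrier) := DFunLike.finite _
      let E : (KerPushout N π f ≃ₗ[A] (V (c f)).carrier) ≃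
          ((V (c f)).carrier ≃ₗ[A] (V (c f)).carrier) :=
        { toFun g := e.symm.trans g
          invFun g := e.trans g
          left_inv g := by ext; simp
          right_inv g := by ext; simp }
      rw [autCard, Nat.card_congr E]
      exact div_self (Nat.cast_ne_zero.2 Nat.card_pos.ne')
    · have : IsEmpty (KerPushout N π f ≃ₗ[A] (V i).carrier) :=
        ⟨fun e ↦ h (hc' f i ⟨e⟩).symm⟩
      simp
  have hPN : (Nat.card ((M →₀ A) →ₗ[A] N) : ℚ) ≠ 0 := Nat.cast_ne_zero.2 Nat.card_pos.ne'
  have hterm (i : ι) : (hallP A M N (V i).carrier : ℚ) / autCard A (V i).carrier =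
      (∑ f : LinearMap.ker π →ₗ[A] N, if c f = i then 1 else 0) /
        Nat.card ((M →₀ A) →ₗ[A] N) := by
    have h := ShortExactPair.card_mul_card_eq_sum (N := N) (L := (V i).carrier) π hπ
    rw [eq_div_iff hPN, div_mul_eq_mul_div, hallP, ← Nat.cast_mul, h, Nat.cast_sum,
      Finset.sum_div]
    exact Finset.sum_congr rfl fun f _ ↦ hiso f i
  have hsupp : (Function.support fun i : ι ↦
      (hallP A M N (V i).carrier : ℚ) / (autCard A (V i).carrier : ℚ)) ⊆
        (Finset.univ.image c : Finset ι) := by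
    intro i hi
    rw [Function.mem_support, hterm] at hi
    by_contra hci
    refine hi ?_
    rw [Finset.sum_eq_zero, zero_div]
    intro f _
    rw [if_neg]
    rintro rfl
    exact hci (by simp)
  refine ⟨.of_surjective d hd, (Finset.finite_toSet _).subset hsupp, ?_⟩
  rw [finsum_eq_sum_of_support_subset _ hsupp, Finset.sum_congr rfl fun i _ ↦ hterm i,
    ← Finset.sum_div, Finset.sum_comm]
  have hone (f : LinearMap.ker π →ₗ[A] N) :
      ∑ i ∈ Finset.univ.image c, (if c f = i then (1 : ℚ) else 0) = 1 := by
    simp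
  simp only [hone, Finset.sum_const, Finset.card_univ, nsmul_eq_mul, mul_one]
  rw [← mul_div_assoc, div_eq_iff hPN, ← Nat.card_eq_fintype_card]
  exact_mod_cast hcard.symm
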